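/- For all integers m ≥ 0 and p ≥ 0 with m + p ≥ 1, we have log F(m,p) ≥ (m+p)² · f(m/(m+p)) − (2m+p)·log 2. -/

import Mathlib

/-- `F(m,p) = ∏_{1 ≤ i < j ≤ p} (2m + i + j − 1)/(i + j − 1)` (empty product is `1`). -/
noncomputable def F (m p : ℕ) : ℝ :=
  ∏ i ∈ Finset.Icc 1 p, ∏ j ∈ Finset.Ioc i p,
    (2 * (m : ℝ) + i + j - 1) / ((i : ℝ) + j - 1)

/-- The function `f(x) = x² log x − ½(1−x)² log(1−x) − ½(1+x)² log(1+x) + 2x log 2`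
(natural logarithms; `Real.log 0 = 0` gives the continuous extension `f 0 = f 1 = 0`). -/
noncomputable def f (x : ℝ) : ℝ :=
  x ^ 2 * Real.log x - (1 / 2) * (1 - x) ^ 2 * Real.log (1 - x)
    - (1 / 2) * (1 + x) ^ 2 * Real.log (1 + x) + 2 * x * Real.log 2

open Real Finset

/-- The antiderivative `∫₀ˢ log ((2a + u) / u) du`, up to an additive constant. -/
noncomputable def logRatioPrimitive (a s : ℝ) : ℝ :=
  (2 * a + s) * log (2 * a + s) - s * log s

/-- The integral of `log ((2a + t + u) / (t + u))` over the triangle `0 < t < u < q`. -/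
noncomputable def triangleIntegral (a q : ℝ) : ℝ :=
  a ^ 2 * log a - 1 / 2 * q ^ 2 * log q - 1 / 2 * (2 * a + q) ^ 2 * log (2 * a + q)
    + (a + q) ^ 2 * log (a + q) + 2 * a * (a + q) * log 2

lemma hasDerivAt_logRatioPrimitive {a s : ℝ} (ha : 0 ≤ a) (hs : 0 < s) :
    HasDerivAt (logRatioPrimitive a) (log (2 * a + s) - log s) s := by
  have h1 : HasDerivAt (fun s : ℝ => 2 * a + s) 1 s := (hasDerivAt_id s).const_add _
  have h2 := (hasDerivAt_mul_log (x := 2 * a + s) (by positivity)).comp s h1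
  exact (h2.sub (hasDerivAt_mul_log hs.ne')).congr_deriv (by ring)

lemma continuous_logRatioPrimitive (a : ℝ) : Continuous (logRatioPrimitive a) :=
  (continuous_mul_log.comp (by fun_prop : Continuous fun s : ℝ => 2 * a + s)).sub
    continuous_mul_log

lemma hasDerivAt_sq_mul_log {x : ℝ} (hx : x ≠ 0) :
    HasDerivAt (fun x : ℝ => x ^ 2 * log x) (2 * x * log x + x) x := by
  refine ((hasDerivAt_pow 2 x).mul (hasDerivAt_log hx)).congr_deriv ?_
  push_cast
  field_simp

lemma continuous_sq_mul_log : Continuous fun x : ℝ => x ^ 2 * log x := by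
  simp only [pow_two, mul_assoc]
  exact continuous_id.mul continuous_mul_log

lemma continuous_triangleIntegral (a : ℝ) : Continuous (triangleIntegral a) := by
  have h1 := continuous_sq_mul_log
  have h2 := h1.comp (by fun_prop : Continuous fun s : ℝ => 2 * a + s)
  have h3 := h1.comp (by fun_prop : Continuous fun s : ℝ => a + s)
  unfold triangleIntegral
  simp only [mul_assoc]
  fun_prop

lemma hasDerivAt_triangleIntegral {a q : ℝ} (ha : 0 ≤ a) (hq : 0 < q) :
    HasDerivAt (triangleIntegral a)
      (logRatioPrimitive a (2 * q) - logRatioPrimitive a q) q := by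
  have h1 : HasDerivAt (fun s : ℝ => 2 * a + s) 1 q := (hasDerivAt_id q).const_add _
  have h2 : HasDerivAt (fun s : ℝ => a + s) 1 q := (hasDerivAt_id q).const_add _
  have d1 := hasDerivAt_sq_mul_log hq.ne'
  have d2 := (hasDerivAt_sq_mul_log (x := 2 * a + q) (by positivity)).comp q h1
  have d3 := (hasDerivAt_sq_mul_log (x := a + q) (by positivity)).comp q h2
  have d := ((((d1.const_mul (1 / 2)).const_sub (a ^ 2 * log a)).sub
    (d2.const_mul (1 / 2))).add d3).add (h2.const_mul (2 * a * log 2))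
  have e1 : log (2 * a + 2 * q) = log 2 + log (a + q) := by
    rw [← mul_add, log_mul two_ne_zero (by positivity)]
  have e2 : log (2 * q) = log 2 + log q := log_mul two_ne_zero hq.ne'
  refine (d.congr_of_eventuallyEq (.of_forall fun x => ?_)).congr_deriv ?_
  · simp only [triangleIntegral, Pi.add_apply, Pi.sub_apply, Function.comp_apply]
    ring
  · rw [logRatioPrimitive, logRatioPrimitive, e1, e2]
    ring

lemma log_add_sub_log_antitone {a s t : ℝ} (ha : 0 ≤ a) (hs : 0 < s) (hst : s ≤ t) :
    log (2 * a + t) - log t ≤ log (2 * a + s) - log s := by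
  have ht := hs.trans_le hst
  rw [← log_div (by positivity) ht.ne', ← log_div (by positivity) hs.ne']
  apply log_le_log (by positivity)
  rw [div_le_div_iff₀ ht hs]
  nlinarith

lemma logRatioPrimitive_mono {a s t : ℝ} (ha : 0 ≤ a) (hs : 0 < s) (hst : s ≤ t) :
    logRatioPrimitive a s ≤ logRatioPrimitive a t := by
  have h : ∀ u ∈ interior (Set.Icc s t), 0 < u := fun u hu =>
    hs.trans (by simpa using (interior_Icc (a := s) (b := t) ▸ hu).1)
  refine monotoneOn_of_deriv_nonneg (convex_Icc s t)
    (continuous_logRatioPrimitive a).continuousOn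
    (fun u hu => (hasDerivAt_logRatioPrimitive ha (h u hu)).differentiableAt.differentiableWithinAt)
    (fun u hu => ?_) (Set.left_mem_Icc.2 hst) (Set.right_mem_Icc.2 hst) hst
  rw [(hasDerivAt_logRatioPrimitive ha (h u hu)).deriv, sub_nonneg]
  exact log_le_log (h u hu) (by linarith)

lemma logRatioPrimitive_add_one_sub_le {a s : ℝ} (ha : 0 ≤ a) (hs : 0 < s) :
    logRatioPrimitive a (s + 1) - logRatioPrimitive a s ≤ log (2 * a + s) - log s := by
  have h : ∀ u ∈ interior (Set.Icc s (s + 1)), s < u := fun u hu =>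
    (interior_Icc (a := s) (b := s + 1) ▸ hu).1
  have := (convex_Icc s (s + 1)).image_sub_le_mul_sub_of_deriv_le
    (continuous_logRatioPrimitive a).continuousOn
    (fun u hu => (hasDerivAt_logRatioPrimitive ha
      (hs.trans (h u hu))).differentiableAt.differentiableWithinAt)
    (C := log (2 * a + s) - log s)
    (fun u hu => by
      rw [(hasDerivAt_logRatioPrimitive ha (hs.trans (h u hu))).deriv]
      exact log_add_sub_log_antitone ha hs (h u hu).le)
    s (by simp) (s + 1) (by simp) (by linarith)
  simpa using this

lemma logRatioPrimitive_add_nat_sub_le {a s : ℝ} (ha : 0 ≤ a) (hs : 0 < s) (n : ℕ) :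
    logRatioPrimitive a (s + n) - logRatioPrimitive a s
      ≤ ∑ i ∈ range n, (log (2 * a + (s + i)) - log (s + i)) := by
  induction n with
  | zero => simp
  | succ n ih =>
    rw [sum_range_succ]
    have := logRatioPrimitive_add_one_sub_le (s := s + n) ha (by positivity)
    push_cast
    rw [← add_assoc]
    linarith

lemma logRatioPrimitive_two_mul_sub_le {a q : ℝ} {p : ℕ} (ha : 0 ≤ a) (hq : 0 < q)
    (hpq : (p : ℝ) ≤ q) (hqp : q ≤ p + 1) :
    logRatioPrimitive a (2 * q) - logRatioPrimitive a q - (log (2 * a + q) - log q)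
      ≤ ∑ i ∈ Icc 1 p, (log (2 * a + i + p) - log (i + p)) := by
  have h1 := logRatioPrimitive_mono (s := 2 * q) (t := q + (p + 1 : ℕ)) ha (by positivity)
    (by push_cast; linarith)
  have h2 := logRatioPrimitive_add_nat_sub_le ha hq (p + 1)
  rw [sum_range_succ'] at h2
  have h3 : ∑ i ∈ range p, (log (2 * a + (q + (i + 1 : ℕ))) - log (q + (i + 1 : ℕ)))
      ≤ ∑ i ∈ Icc 1 p, (log (2 * a + i + p) - log (i + p)) := by
    rw [range_eq_Ico, sum_Ico_add' (fun i : ℕ => log (2 * a + (q + i)) - log (q + i)) 0 p 1]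
    refine sum_le_sum fun i hi => ?_
    have hi : (1 : ℝ) ≤ i := by exact_mod_cast (mem_Icc.1 hi).1
    rw [add_assoc]
    exact log_add_sub_log_antitone ha (by positivity) (by linarith)
  simp only [Nat.cast_zero, add_zero] at h2
  linarith

lemma triangleIntegral_sub_succ_le {a : ℝ} (ha : 0 ≤ a) (p : ℕ) :
    (triangleIntegral a (p + 1) - logRatioPrimitive a (p + 1))
        - (triangleIntegral a p - logRatioPrimitive a p)
      ≤ ∑ i ∈ Icc 1 p, (log (2 * a + i + p) - log (i + p)) := by
  have h : ∀ u ∈ interior (Set.Icc (p : ℝ) (p + 1)), (p : ℝ) < u ∧ u < p + 1 := fun u hu =>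
    by rwa [interior_Icc] at hu
  have hd : ∀ u ∈ interior (Set.Icc (p : ℝ) (p + 1)),
      HasDerivAt (triangleIntegral a - logRatioPrimitive a)
        (logRatioPrimitive a (2 * u) - logRatioPrimitive a u - (log (2 * a + u) - log u)) u :=
    fun u hu =>
      have hu0 : 0 < u := p.cast_nonneg.trans_lt (h u hu).1
      (hasDerivAt_triangleIntegral ha hu0).sub (hasDerivAt_logRatioPrimitive ha hu0)
  have := (convex_Icc (p : ℝ) (p + 1)).image_sub_le_mul_sub_of_deriv_le
    ((continuous_triangleIntegral a).sub (continuous_logRatioPrimitive a)).continuousOn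
    (fun u hu => (hd u hu).differentiableAt.differentiableWithinAt)
    (C := ∑ i ∈ Icc 1 p, (log (2 * a + i + p) - log (i + p)))
    (fun u hu => by
      rw [(hd u hu).deriv]
      exact logRatioPrimitive_two_mul_sub_le ha (p.cast_nonneg.trans_lt (h u hu).1)
        (h u hu).1.le (h u hu).2.le)
    p (by simp) (p + 1) (by simp) (by linarith)
  simpa using this

lemma F_pos (m p : ℕ) : 0 < F m p := by
  refine prod_pos fun i hi => prod_pos fun j hj => ?_
  have hi : (1 : ℝ) ≤ i := by exact_mod_cast (mem_Icc.1 hi).1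
  have hj : (i : ℝ) < j := by exact_mod_cast (mem_Ioc.1 hj).1
  have hm : (0 : ℝ) ≤ m := m.cast_nonneg
  exact div_pos (by linarith) (by linarith)

lemma F_succ (m p : ℕ) :
    F m (p + 1) = F m p * ∏ i ∈ Icc 1 p, ((2 * (m : ℝ) + i + p) / (i + p)) := by
  unfold F
  rw [prod_Icc_succ_top (by omega), Ioc_self, prod_empty, mul_one, ← prod_mul_distrib]
  refine prod_congr rfl fun i hi => ?_
  rw [prod_Ioc_succ_top (mem_Icc.1 hi).2]
  push_cast
  ring_nf

lemma log_F_succ (m p : ℕ) :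
    log (F m (p + 1))
      = log (F m p) + ∑ i ∈ Icc 1 p, (log (2 * (m : ℝ) + i + p) - log (i + p)) := by
  have hpos : ∀ i ∈ Icc 1 p, (0 : ℝ) < i := fun i hi => by exact_mod_cast (mem_Icc.1 hi).1
  have h : ∀ i ∈ Icc 1 p, (2 * (m : ℝ) + i + p) / (i + p) ≠ 0 := fun i hi => by
    have := hpos i hi
    positivity
  rw [F_succ, log_mul (F_pos m p).ne' (prod_ne_zero_iff.2 h), log_prod h]
  congr 1
  refine sum_congr rfl fun i hi => ?_
  have := hpos i hi
  rw [log_div (by positivity) (by positivity)]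

lemma triangleIntegral_zero (a : ℝ) : triangleIntegral a 0 = 0 := by
  rcases eq_or_ne a 0 with rfl | ha
  · simp [triangleIntegral]
  · simp only [triangleIntegral, add_zero, log_mul two_ne_zero ha]
    ring

lemma triangleIntegral_sub_le_log_F (m p : ℕ) :
    triangleIntegral m p - (logRatioPrimitive m p - logRatioPrimitive m 0) ≤ log (F m p) := by
  induction p with
  | zero => simp [triangleIntegral_zero, F]
  | succ p ih =>
    rw [log_F_succ]
    have := triangleIntegral_sub_succ_le (a := m) m.cast_nonneg p
    push_cast
    linarith

lemma add_mul_log_add_le {a b : ℝ} (ha : 0 ≤ a) (hb : 0 ≤ b) :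
    (a + b) * log (a + b) ≤ a * log a + b * log b + (a + b) * log 2 := by
  rcases (add_nonneg ha hb).eq_or_lt with h | h
  · obtain ⟨rfl, rfl⟩ : a = 0 ∧ b = 0 := ⟨by linarith, by linarith⟩
    simp
  · have := convexOn_mul_log.2 (Set.mem_Ici.2 ha) (Set.mem_Ici.2 hb)
      (by norm_num : (0 : ℝ) ≤ 1 / 2) (by norm_num : (0 : ℝ) ≤ 1 / 2) (by norm_num)
    simp only [smul_eq_mul] at this
    rw [show 1 / 2 * a + 1 / 2 * b = (a + b) / 2 by ring, log_div h.ne' two_ne_zero] at this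
    linarith

lemma sq_mul_log_div (x : ℝ) {y : ℝ} (hy : y ≠ 0) :
    x ^ 2 * log (x / y) = x ^ 2 * (log x - log y) := by
  rcases eq_or_ne x 0 with rfl | hx
  · simp
  · rw [log_div hx hy]

lemma sq_mul_f_div {a q : ℝ} (h : a + q ≠ 0) :
    (a + q) ^ 2 * f (a / (a + q)) = triangleIntegral a q := by
  have e1 : 1 - a / (a + q) = q / (a + q) := by field_simp; ring
  have e2 : 1 + a / (a + q) = (2 * a + q) / (a + q) := by field_simp; ring
  have key : (a + q) ^ 2 * f (a / (a + q)) = a ^ 2 * log (a / (a + q))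
      - 1 / 2 * (q ^ 2 * log (q / (a + q)))
      - 1 / 2 * ((2 * a + q) ^ 2 * log ((2 * a + q) / (a + q))) + 2 * a * (a + q) * log 2 := by
    rw [f, e1, e2]
    field_simp
  rw [key, sq_mul_log_div a h, sq_mul_log_div q h, sq_mul_log_div (2 * a + q) h,
    triangleIntegral]
  ring

/-- For all integers `m ≥ 0`, `p ≥ 0` with `m + p ≥ 1`:
`log F(m,p) ≥ (m+p)² f(m/(m+p)) − (2m+p) log 2`. -/
theorem log_F_lower (m p : ℕ) (h : 1 ≤ m + p) :
    ((m : ℝ) + p) ^ 2 * f ((m : ℝ) / (m + p)) - (2 * (m : ℝ) + p) * Real.log 2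
      ≤ Real.log (F m p) := by
  have h0 : (m : ℝ) + p ≠ 0 := by exact_mod_cast (by omega : m + p ≠ 0)
  rw [sq_mul_f_div h0]
  have h1 := triangleIntegral_sub_le_log_F m p
  have h2 := add_mul_log_add_le (a := 2 * (m : ℝ)) (b := p) (by positivity) (by positivity)
  simp only [logRatioPrimitive, add_zero, zero_mul, sub_zero] at h1
  linarith
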